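/- arXiv:0907.0724 — 2 statements merged into one kernel-verified Lean document; each statement's English description precedes it below -/
import Mathlib

section
/- Let S be a set of n points in ℝ³, no three collinear and not all coplanar, and let m be the total number of planes determined by S. Then 6m ≥ 3n + Σ_{k≥3} C(k,2)·m_k. -/
open Set

noncomputable section

/-- Three-dimensional euclidean space. -/
abbrev Pt3 := EuclideanSpace ℝ (Fin 3)

/-- A plane in space: the affine span of three affinely independent points. -/
def IsPlane (P : Set Pt3) : Prop :=
  ∃ a b c : Pt3, AffineIndependent ℝ ![a, b, c] ∧
    P = (affineSpan ℝ ({a, b, c} : Set Pt3) : Set Pt3)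

/-- `planeCount S k` is the number of planes containing exactly `k` points of `S`. -/
def planeCount (S : Set Pt3) (k : ℕ) : ℕ :=
  {P : Set Pt3 | IsPlane P ∧ (S ∩ P).ncard = k}.ncard

/-- The planes determined by `S`: planes containing at least three points of `S`. -/
def detPlanes (S : Set Pt3) : Set (Set Pt3) :=
  {P : Set Pt3 | IsPlane P ∧ 3 ≤ (S ∩ P).ncard}

/-- No three points of `S` are collinear. -/
def NoThreeCollinear (S : Set Pt3) : Prop :=
  ∀ T ⊆ S, T.ncard = 3 → ¬ Collinear ℝ T

section Melchior

variable {ι : Type*} [Fintype ι] (a b : ι → ℝ)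

/-- The indices of the lines `y = a i * t + b i` passing through the point `v`. -/
def linesThrough (v : ℝ × ℝ) : Finset ι :=
  open Classical in Finset.univ.filter fun i => a i * v.1 + b i = v.2

/-- The points lying on at least two of the lines `y = a i * t + b i`. -/
def crossings : Finset (ℝ × ℝ) :=
  open Classical in
  (Finset.univ.filter fun p : ι × ι => p.1 ≠ p.2).image fun p =>
    ((b p.2 - b p.1) / (a p.1 - a p.2), a p.1 * ((b p.2 - b p.1) / (a p.1 - a p.2)) + b p.1)

variable {a b}

theorem mem_linesThrough {v : ℝ × ℝ} {i : ι} :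
    i ∈ linesThrough a b v ↔ a i * v.1 + b i = v.2 := by
  simp [linesThrough]

theorem mem_crossings (ha : Function.Injective a) {v : ℝ × ℝ} :
    v ∈ crossings a b ↔ ∃ i j, i ≠ j ∧ i ∈ linesThrough a b v ∧ j ∈ linesThrough a b v := by
  simp only [crossings, mem_linesThrough, Finset.mem_image, Finset.mem_filter, Finset.mem_univ,
    true_and, Prod.exists]
  refine exists_congr fun i => exists_congr fun j => and_congr_right fun hij => ?_
  have h : a i - a j ≠ 0 := sub_ne_zero.2 fun h => hij (ha h)
  obtain ⟨t, y⟩ := v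
  simp only [Prod.mk.injEq]
  constructor
  · rintro ⟨rfl, rfl⟩
    refine ⟨rfl, ?_⟩
    field_simp
    ring
  · rintro ⟨h1, h2⟩
    have : (b j - b i) / (a i - a j) = t := by
      rw [div_eq_iff h]; linarith
    rw [this]
    exact ⟨rfl, h1⟩

theorem exists_crossing (ha : Function.Injective a) {i j : ι} (hij : i ≠ j) :
    ∃ v ∈ crossings a b, i ∈ linesThrough a b v ∧ j ∈ linesThrough a b v := by
  have h : a i - a j ≠ 0 := sub_ne_zero.2 fun h => hij (ha h)
  have hi : i ∈ linesThrough a b ((b j - b i) / (a i - a j),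
      a i * ((b j - b i) / (a i - a j)) + b i) := mem_linesThrough.2 rfl
  have hj : j ∈ linesThrough a b ((b j - b i) / (a i - a j),
      a i * ((b j - b i) / (a i - a j)) + b i) := by
    rw [mem_linesThrough]; field_simp; ring
  exact ⟨_, (mem_crossings ha).2 ⟨i, j, hij, hi, hj⟩, hi, hj⟩

theorem line_lt_of_lt {v : ℝ × ℝ} {i j : ι} (hi : i ∈ linesThrough a b v)
    (hj : j ∈ linesThrough a b v) (hij : a i < a j) {t : ℝ} (ht : v.1 < t) :
    a i * t + b i < a j * t + b j := by
  rw [mem_linesThrough] at hi hj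
  nlinarith [mul_pos (sub_pos.2 hij) (sub_pos.2 ht)]

theorem line_gt_of_gt {v : ℝ × ℝ} {i j : ι} (hi : i ∈ linesThrough a b v)
    (hj : j ∈ linesThrough a b v) (hij : a i < a j) {t : ℝ} (ht : t < v.1) :
    a j * t + b j < a i * t + b i := by
  rw [mem_linesThrough] at hi hj
  nlinarith [mul_pos (sub_pos.2 hij) (sub_pos.2 ht)]

theorem eq_of_mem_linesThrough {v w : ℝ × ℝ} {i : ι} (hv : i ∈ linesThrough a b v)
    (hw : i ∈ linesThrough a b w) (h : v.1 = w.1) : v = w := by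
  rw [mem_linesThrough] at hv hw
  refine Prod.ext h ?_
  rw [← hv, ← hw, h]

theorem crossing_unique (ha : Function.Injective a) {v w : ℝ × ℝ} {i j : ι} (hij : i ≠ j)
    (hiv : i ∈ linesThrough a b v) (hjv : j ∈ linesThrough a b v)
    (hiw : i ∈ linesThrough a b w) (hjw : j ∈ linesThrough a b w) : v = w := by
  refine eq_of_mem_linesThrough hiv hiw ?_
  rw [mem_linesThrough] at *
  have h : a i - a j ≠ 0 := sub_ne_zero.2 fun h => hij (ha h)
  apply mul_left_cancel₀ h
  linarith

/-- A line that crosses from below to above a flatter one between times `s` and `t` does so at a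
crossing. -/
theorem exists_crossing_between (ha : Function.Injective a) {i j : ι} {s t : ℝ}
    (hs : a j * s + b j < a i * s + b i) (ht : a i * t + b i < a j * t + b j) (hst : s < t) :
    ∃ v ∈ crossings a b, i ∈ linesThrough a b v ∧ j ∈ linesThrough a b v ∧ s < v.1 ∧ v.1 < t := by
  have hij : a i < a j := by
    by_contra! h
    nlinarith [mul_nonneg (sub_nonneg.2 h) (sub_pos.2 hst).le]
  obtain ⟨v, hv, hi, hj⟩ := exists_crossing (b := b) ha (i := i) (j := j)
    (fun h => by simp [h] at hij)
  refine ⟨v, hv, hi, hj, ?_, ?_⟩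
  · by_contra! h
    rcases h.lt_or_eq with h | h
    · exact (line_lt_of_lt hi hj hij h).not_gt hs
    · rw [mem_linesThrough, h] at hi hj; linarith
  · by_contra! h
    rcases h.lt_or_eq with h | h
    · exact (line_gt_of_gt hi hj hij h).not_gt ht
    · rw [mem_linesThrough, ← h] at hi hj; linarith

theorem exists_crossing_ne (ha : Function.Injective a)
    (hc : ∀ v, ∃ i, i ∉ linesThrough a b v) (i : ι) (v : ℝ × ℝ) :
    ∃ w ∈ crossings a b, i ∈ linesThrough a b w ∧ w ≠ v := by
  by_cases hi : i ∈ linesThrough a b v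
  · obtain ⟨j, hj⟩ := hc v
    obtain ⟨w, hw, hiw, hjw⟩ := exists_crossing (b := b) ha (i := i) (j := j)
      (fun h => hj (h ▸ hi))
    exact ⟨w, hw, hiw, fun h => hj (h ▸ hjw)⟩
  · obtain ⟨j, hj⟩ := hc (0, b i)
    obtain ⟨w, hw, hiw, hjw⟩ := exists_crossing (b := b) ha (i := i) (j := j)
      (fun h => hj (h ▸ by simp [mem_linesThrough]))
    exact ⟨w, hw, hiw, fun h => hi (h ▸ hiw)⟩

/-- The first crossing with property `p`. -/
theorem exists_first_crossing (p : ℝ × ℝ → Prop) (h : ∃ v ∈ crossings a b, p v) :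
    ∃ v ∈ crossings a b, p v ∧ ∀ w ∈ crossings a b, p w → v.1 ≤ w.1 := by
  classical
  obtain ⟨v, hv, hpv⟩ := h
  obtain ⟨w, hw, hmin⟩ := ((crossings a b).filter p).exists_min_image Prod.fst
    ⟨v, Finset.mem_filter.2 ⟨hv, hpv⟩⟩
  rw [Finset.mem_filter] at hw
  exact ⟨w, hw.1, hw.2, fun u hu hpu => hmin u (Finset.mem_filter.2 ⟨hu, hpu⟩)⟩

theorem exists_last_crossing (p : ℝ × ℝ → Prop) (h : ∃ v ∈ crossings a b, p v) :
    ∃ v ∈ crossings a b, p v ∧ ∀ w ∈ crossings a b, p w → w.1 ≤ v.1 := by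
  classical
  obtain ⟨v, hv, hpv⟩ := h
  obtain ⟨w, hw, hmax⟩ := ((crossings a b).filter p).exists_max_image Prod.fst
    ⟨v, Finset.mem_filter.2 ⟨hv, hpv⟩⟩
  rw [Finset.mem_filter] at hw
  exact ⟨w, hw.1, hw.2, fun u hu hpu => hmax u (Finset.mem_filter.2 ⟨hu, hpu⟩)⟩

variable (a b) in
/-- `i` is the line just below `j` immediately to the right of the crossing `v`. -/
def IsPred (v : ℝ × ℝ) (i j : ι) : Prop :=
  i ∈ linesThrough a b v ∧ j ∈ linesThrough a b v ∧ a i < a j ∧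
    ∀ k ∈ linesThrough a b v, a k < a j → a k ≤ a i

theorem IsPred.left_unique (ha : Function.Injective a) {v : ℝ × ℝ} {i i' j : ι}
    (h : IsPred a b v i j) (h' : IsPred a b v i' j) : i = i' :=
  ha ((h'.2.2.2 i h.1 h.2.2.1).antisymm (h.2.2.2 i' h'.1 h'.2.2.1))

theorem IsPred.right_unique (ha : Function.Injective a) {v : ℝ × ℝ} {i j j' : ι}
    (h : IsPred a b v i j) (h' : IsPred a b v i j') : j = j' := by
  apply ha
  by_contra hne
  rcases lt_or_gt_of_ne hne with hlt | hlt
  · exact (h'.2.2.2 j h.2.1 hlt).not_gt h.2.2.1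
  · exact (h.2.2.2 j' h'.2.1 hlt).not_gt h'.2.2.1

theorem exists_isPred {v : ℝ × ℝ} {j k : ι} (hj : j ∈ linesThrough a b v)
    (hk : k ∈ linesThrough a b v) (hkj : a k < a j) : ∃ i, IsPred a b v i j := by
  classical
  obtain ⟨i, hi, hmax⟩ := ((linesThrough a b v).filter fun k => a k < a j).exists_max_image a
    ⟨k, Finset.mem_filter.2 ⟨hk, hkj⟩⟩
  rw [Finset.mem_filter] at hi
  exact ⟨i, hi.1, hj, hi.2, fun k hk hkj => hmax k (Finset.mem_filter.2 ⟨hk, hkj⟩)⟩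

variable (a b) in
/-- `i` is the steepest line through `w`. -/
def IsSteepest (w : ℝ × ℝ) (i : ι) : Prop :=
  i ∈ linesThrough a b w ∧ ∀ k ∈ linesThrough a b w, a k ≤ a i

variable (a b) in
/-- `i` is the line of least slope through `w`. -/
def IsShallowest (w : ℝ × ℝ) (i : ι) : Prop :=
  i ∈ linesThrough a b w ∧ ∀ k ∈ linesThrough a b w, a i ≤ a k

theorem IsSteepest.unique (ha : Function.Injective a) {w : ℝ × ℝ} {i j : ι}
    (hi : IsSteepest a b w i) (hj : IsSteepest a b w j) : i = j :=
  ha ((hj.2 i hi.1).antisymm (hi.2 j hj.1))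

theorem IsShallowest.unique (ha : Function.Injective a) {w : ℝ × ℝ} {i j : ι}
    (hi : IsShallowest a b w i) (hj : IsShallowest a b w j) : i = j :=
  ha ((hi.2 j hj.1).antisymm (hj.2 i hi.1))

variable (a b) in
/-- `w` is the crossing on the line `i` immediately to the right of `v`. -/
def IsNext (v w : ℝ × ℝ) (i : ι) : Prop :=
  v.1 < w.1 ∧ ∀ u ∈ crossings a b, i ∈ linesThrough a b u → u.1 ≤ v.1 ∨ w.1 ≤ u.1

variable (a b) in
/-- `w` is the first and `v` the last crossing on the line `i`, and they are distinct. -/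
def IsWrap (v w : ℝ × ℝ) (i : ι) : Prop :=
  w.1 < v.1 ∧ ∀ u ∈ crossings a b, i ∈ linesThrough a b u → w.1 ≤ u.1 ∧ u.1 ≤ v.1

theorem eq_of_isNext_or_isWrap {v v' w : ℝ × ℝ} {i : ι} (hv : v ∈ crossings a b)
    (hv' : v' ∈ crossings a b) (hi : i ∈ linesThrough a b v) (hi' : i ∈ linesThrough a b v')
    (h : IsNext a b v w i ∨ IsWrap a b v w i) (h' : IsNext a b v' w i ∨ IsWrap a b v' w i) :
    v = v' := by
  refine eq_of_mem_linesThrough hi hi' ?_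
  rcases h with ⟨h1, h2⟩ | ⟨h1, h2⟩ <;> rcases h' with ⟨h3, h4⟩ | ⟨h3, h4⟩ <;>
  have h5 := h2 v' hv' hi' <;> have h6 := h4 v hv hi <;> grind

variable (a b) in
/-- The cell of the projective arrangement lying between the consecutive lines `i` and `j` to the
right of the crossing `v` has, as the first vertex after `v` on its boundary, the point `w`. The
Boolean tells whether the cell lies below (`true`) or above (`false`) the point `w`. -/
inductive SectorMeets (v : ℝ × ℝ) (i j : ι) (w : ℝ × ℝ) : Bool → Prop
  | next_top : IsNext a b v w j → IsSteepest a b w j → SectorMeets v i j w true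
  | wrap_top : IsWrap a b v w i → IsSteepest a b w i → SectorMeets v i j w true
  | next_bot : IsNext a b v w i → IsShallowest a b w i → SectorMeets v i j w false
  | wrap_bot : IsWrap a b v w j → IsShallowest a b w j → SectorMeets v i j w false

theorem SectorMeets.unique (ha : Function.Injective a) {v v' w : ℝ × ℝ} {i j i' j' : ι} {c : Bool}
    (hv : v ∈ crossings a b) (hv' : v' ∈ crossings a b)
    (hp : IsPred a b v i j) (hp' : IsPred a b v' i' j')
    (h : SectorMeets a b v i j w c) (h' : SectorMeets a b v' i' j' w c) : v = v' ∧ j = j' := by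
  cases h with
  | next_top h hs => cases h' with
    | next_top h' hs' =>
      obtain rfl := hs.unique ha hs'
      exact ⟨eq_of_isNext_or_isWrap hv hv' hp.2.1 hp'.2.1 (.inl h) (.inl h'), rfl⟩
    | wrap_top h' hs' =>
      obtain rfl := hs.unique ha hs'
      obtain rfl := eq_of_isNext_or_isWrap hv hv' hp.2.1 hp'.1 (.inl h) (.inr h')
      exact absurd h.1 h'.1.not_gt
  | wrap_top h hs => cases h' with
    | next_top h' hs' =>
      obtain rfl := hs.unique ha hs'
      obtain rfl := eq_of_isNext_or_isWrap hv hv' hp.1 hp'.2.1 (.inr h) (.inl h')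
      exact absurd h.1 h'.1.not_gt
    | wrap_top h' hs' =>
      obtain rfl := hs.unique ha hs'
      obtain rfl := eq_of_isNext_or_isWrap hv hv' hp.1 hp'.1 (.inr h) (.inr h')
      exact ⟨rfl, hp.right_unique ha hp'⟩
  | next_bot h hs => cases h' with
    | next_bot h' hs' =>
      obtain rfl := hs.unique ha hs'
      obtain rfl := eq_of_isNext_or_isWrap hv hv' hp.1 hp'.1 (.inl h) (.inl h')
      exact ⟨rfl, hp.right_unique ha hp'⟩
    | wrap_bot h' hs' =>
      obtain rfl := hs.unique ha hs'
      obtain rfl := eq_of_isNext_or_isWrap hv hv' hp.1 hp'.2.1 (.inl h) (.inr h')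
      exact absurd h.1 h'.1.not_gt
  | wrap_bot h hs => cases h' with
    | next_bot h' hs' =>
      obtain rfl := hs.unique ha hs'
      obtain rfl := eq_of_isNext_or_isWrap hv hv' hp.2.1 hp'.1 (.inr h) (.inl h')
      exact absurd h.1 h'.1.not_gt
    | wrap_bot h' hs' =>
      obtain rfl := hs.unique ha hs'
      exact ⟨eq_of_isNext_or_isWrap hv hv' hp.2.1 hp'.2.1 (.inr h) (.inr h'), rfl⟩

theorem SectorMeets.exists_below {v w : ℝ × ℝ} {i j : ι} (hp : IsPred a b v i j)
    (h : SectorMeets a b v i j w true) : ∃ k, a k * w.1 + b k < w.2 := by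
  cases h with
  | next_top h hs =>
    have := line_lt_of_lt hp.1 hp.2.1 hp.2.2.1 h.1
    exact ⟨i, by rwa [mem_linesThrough.1 hs.1] at this⟩
  | wrap_top h hs =>
    have := line_gt_of_gt hp.1 hp.2.1 hp.2.2.1 h.1
    exact ⟨j, by rwa [mem_linesThrough.1 hs.1] at this⟩

theorem SectorMeets.exists_above {v w : ℝ × ℝ} {i j : ι} (hp : IsPred a b v i j)
    (h : SectorMeets a b v i j w false) : ∃ k, w.2 < a k * w.1 + b k := by
  cases h with
  | next_bot h hs =>
    have := line_lt_of_lt hp.1 hp.2.1 hp.2.2.1 h.1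
    exact ⟨j, by rwa [mem_linesThrough.1 hs.1] at this⟩
  | wrap_bot h hs =>
    have := line_gt_of_gt hp.1 hp.2.1 hp.2.2.1 h.1
    exact ⟨i, by rwa [mem_linesThrough.1 hs.1] at this⟩

theorem exists_sectorMeets (ha : Function.Injective a) (hc : ∀ v, ∃ i, i ∉ linesThrough a b v)
    {v : ℝ × ℝ} {i j : ι} (hv : v ∈ crossings a b) (hp : IsPred a b v i j) :
    ∃ w ∈ crossings a b, ∃ c, SectorMeets a b v i j w c := by
  obtain ⟨hi, hj, hij, -⟩ := hp
  have hvi := mem_linesThrough.1 hi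
  have hvj := mem_linesThrough.1 hj
  by_cases hr : ∃ w ∈ crossings a b, v.1 < w.1 ∧ (i ∈ linesThrough a b w ∨ j ∈ linesThrough a b w)
  · obtain ⟨w, hw, ⟨hvw, hij'⟩, hmin⟩ := exists_first_crossing _ hr
    have hlt := line_lt_of_lt hi hj hij hvw
    have next {l : ι} (hl : l = i ∨ l = j) : IsNext a b v w l := ⟨hvw, fun u hu hlu => by
      by_contra! h
      exact (hmin u hu ⟨h.1, by rcases hl with rfl | rfl <;> simp [hlu]⟩).not_gt h.2⟩
    refine ⟨w, hw, ?_⟩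
    rcases hij' with hiw | hjw
    · refine ⟨false, .next_bot (next (.inl rfl)) ⟨hiw, fun k hk => ?_⟩⟩
      by_contra! hki
      have h1 := line_gt_of_gt hk hiw hki hvw
      have hiw' := mem_linesThrough.1 hiw
      have hkw := mem_linesThrough.1 hk
      obtain ⟨u, hu, -, hju, h2, h3⟩ := exists_crossing_between ha (i := k) (j := j)
        (s := v.1) (t := w.1) (by linarith) (by linarith) hvw
      exact (hmin u hu ⟨h2, .inr hju⟩).not_gt h3
    · refine ⟨true, .next_top (next (.inr rfl)) ⟨hjw, fun k hk => ?_⟩⟩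
      by_contra! hki
      have h1 := line_gt_of_gt hjw hk hki hvw
      have hjw' := mem_linesThrough.1 hjw
      have hkw := mem_linesThrough.1 hk
      obtain ⟨u, hu, hiu, -, h2, h3⟩ := exists_crossing_between ha (i := i) (j := k)
        (s := v.1) (t := w.1) (by linarith) (by linarith) hvw
      exact (hmin u hu ⟨h2, .inl hiu⟩).not_gt h3
  · push Not at hr
    obtain ⟨w, hw, hij', hmin⟩ := exists_first_crossing
      (fun w => i ∈ linesThrough a b w ∨ j ∈ linesThrough a b w) ⟨v, hv, .inl hi⟩
    have hlast {l : ι} (hl : l = i ∨ l = j) {u : ℝ × ℝ} (hu : u ∈ crossings a b)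
        (hlu : l ∈ linesThrough a b u) : u.1 ≤ v.1 := by
      by_contra! h
      rcases hl with rfl | rfl
      · exact (hr u hu h).1 hlu
      · exact (hr u hu h).2 hlu
    have hfirst {l : ι} (hl : l = i ∨ l = j) {u : ℝ × ℝ} (hu : u ∈ crossings a b)
        (hlu : l ∈ linesThrough a b u) : w.1 ≤ u.1 :=
      hmin u hu (by rcases hl with rfl | rfl <;> simp [hlu])
    have hwv : w.1 < v.1 := by
      obtain ⟨u, hu, hiu, huv⟩ := exists_crossing_ne ha hc i v
      have h1 := hfirst (.inl rfl) hu hiu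
      exact h1.trans_lt ((hlast (.inl rfl) hu hiu).lt_of_ne
        fun h => huv (eq_of_mem_linesThrough hiu hi h))
    have wrap {l : ι} (hl : l = i ∨ l = j) : IsWrap a b v w l :=
      ⟨hwv, fun u hu hlu => ⟨hfirst hl hu hlu, hlast hl hu hlu⟩⟩
    have hlt := line_gt_of_gt hi hj hij hwv
    refine ⟨w, hw, ?_⟩
    rcases hij' with hiw | hjw
    · refine ⟨true, .wrap_top (wrap (.inl rfl)) ⟨hiw, fun k hk => ?_⟩⟩
      by_contra! hki
      have h1 := line_lt_of_lt hiw hk hki hwv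
      have hiw' := mem_linesThrough.1 hiw
      have hkw := mem_linesThrough.1 hk
      have hjk : j ≠ k := by rintro rfl; linarith
      obtain ⟨u, hu, hju, hku⟩ := exists_crossing (b := b) ha hjk
      have h2 := hfirst (.inr rfl) hu hju
      have h3 := hlast (.inr rfl) hu hju
      rw [mem_linesThrough] at hju hku
      rcases le_total (a j) (a k) with h | h
      · nlinarith [mul_nonneg (sub_nonneg.2 h) (sub_nonneg.2 h2)]
      · nlinarith [mul_nonneg (sub_nonneg.2 h) (sub_nonneg.2 h3)]
    · refine ⟨false, .wrap_bot (wrap (.inr rfl)) ⟨hjw, fun k hk => ?_⟩⟩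
      by_contra! hki
      have h1 := line_lt_of_lt hk hjw hki hwv
      have hjw' := mem_linesThrough.1 hjw
      have hkw := mem_linesThrough.1 hk
      have hik : i ≠ k := by rintro rfl; linarith
      obtain ⟨u, hu, hiu, hku⟩ := exists_crossing (b := b) ha hik
      have h2 := hfirst (.inl rfl) hu hiu
      have h3 := hlast (.inl rfl) hu hiu
      rw [mem_linesThrough] at hiu hku
      rcases le_total (a i) (a k) with h | h
      · nlinarith [mul_nonneg (sub_nonneg.2 h) (sub_nonneg.2 h3)]
      · nlinarith [mul_nonneg (sub_nonneg.2 h) (sub_nonneg.2 h2)]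

/-- The lower and upper envelopes of the arrangement have at least three vertices altogether. -/
theorem three_le_card_envelope (ha : Function.Injective a)
    (hc : ∀ v, ∃ i, i ∉ linesThrough a b v) :
    ∃ M ⊆ crossings a b ×ˢ (Finset.univ : Finset Bool), 3 ≤ M.card ∧
      ∀ x ∈ M, (x.2 = true → ∀ k, x.1.2 ≤ a k * x.1.1 + b k) ∧
        (x.2 = false → ∀ k, a k * x.1.1 + b k ≤ x.1.2) := by
  classical
  obtain ⟨l, -⟩ := hc 0
  obtain ⟨i, -, hi⟩ := Finset.univ.exists_min_image a ⟨l, Finset.mem_univ l⟩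
  obtain ⟨j, -, hj⟩ := Finset.univ.exists_max_image a ⟨l, Finset.mem_univ l⟩
  have hon (l : ι) : ∃ v ∈ crossings a b, l ∈ linesThrough a b v :=
    let ⟨w, hw, hlw, _⟩ := exists_crossing_ne (b := b) ha hc l 0
    ⟨w, hw, hlw⟩
  obtain ⟨p, hp, hjp, hpmin⟩ := exists_first_crossing _ (hon j)
  obtain ⟨q, hq, hiq, hqmax⟩ := exists_last_crossing _ (hon i)
  obtain ⟨r, hr, hjr, hrmax⟩ := exists_last_crossing _ (hon j)
  obtain ⟨s, hs, his, hsmin⟩ := exists_first_crossing _ (hon i)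
  have lt_j {k : ι} (h : j ≠ k) : a k < a j :=
    (hj k (Finset.mem_univ k)).lt_of_ne fun h' => h (ha h'.symm)
  have i_lt {k : ι} (h : i ≠ k) : a i < a k :=
    (hi k (Finset.mem_univ k)).lt_of_ne fun h' => h (ha h')
  have hplow (k : ι) : p.2 ≤ a k * p.1 + b k := by
    by_contra! h
    rw [← mem_linesThrough.1 hjp] at h
    have hjk : j ≠ k := by rintro rfl; exact h.false
    obtain ⟨u, hu, hju, hku⟩ := exists_crossing (b := b) ha hjk
    rcases (hpmin u hu hju).lt_or_eq with h' | h'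
    · exact h.not_gt (line_gt_of_gt hku hju (lt_j hjk) h')
    · rw [mem_linesThrough, ← h'] at hju hku; linarith
  have hqlow (k : ι) : q.2 ≤ a k * q.1 + b k := by
    by_contra! h
    rw [← mem_linesThrough.1 hiq] at h
    have hik : i ≠ k := by rintro rfl; exact h.false
    obtain ⟨u, hu, hiu, hku⟩ := exists_crossing (b := b) ha hik
    rcases (hqmax u hu hiu).lt_or_eq with h' | h'
    · exact h.not_gt (line_lt_of_lt hiu hku (i_lt hik) h')
    · rw [mem_linesThrough, h'] at hiu hku; linarith
  have hrup (k : ι) : a k * r.1 + b k ≤ r.2 := by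
    by_contra! h
    rw [← mem_linesThrough.1 hjr] at h
    have hjk : j ≠ k := by rintro rfl; exact h.false
    obtain ⟨u, hu, hju, hku⟩ := exists_crossing (b := b) ha hjk
    rcases (hrmax u hu hju).lt_or_eq with h' | h'
    · exact h.not_gt (line_lt_of_lt hku hju (lt_j hjk) h')
    · rw [mem_linesThrough, h'] at hju hku; linarith
  have hsup (k : ι) : a k * s.1 + b k ≤ s.2 := by
    by_contra! h
    rw [← mem_linesThrough.1 his] at h
    have hik : i ≠ k := by rintro rfl; exact h.false
    obtain ⟨u, hu, hiu, hku⟩ := exists_crossing (b := b) ha hik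
    rcases (hsmin u hu hiu).lt_or_eq with h' | h'
    · exact h.not_gt (line_gt_of_gt hiu hku (i_lt hik) h')
    · rw [mem_linesThrough, ← h'] at hiu hku; linarith
  have hpr : p ≠ r := by
    rintro rfl
    obtain ⟨u, hu, hju, hup⟩ := exists_crossing_ne ha hc j p
    exact hup (eq_of_mem_linesThrough hju hjp ((hrmax u hu hju).antisymm (hpmin u hu hju)))
  have hij : i ≠ j := by
    rintro rfl
    obtain ⟨k, hk⟩ := hc (0, b i)
    have hik : i ≠ k := by rintro rfl; exact hk (by simp [mem_linesThrough])
    exact (i_lt hik).not_gt (lt_j hik)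
  by_cases hpq : p = q
  · have hrs : r ≠ s := by
      rintro rfl
      subst hpq
      exact hpr (crossing_unique ha hij hiq hjp his hjr)
    refine ⟨{(p, true), (r, false), (s, false)}, ?_, ?_, ?_⟩
    · simp [Finset.insert_subset_iff, hp, hr, hs]
    · rw [Finset.card_eq_three.2 ⟨_, _, _, ?_, ?_, ?_, rfl⟩] <;> simp [hrs]
    · simp only [Finset.mem_insert, Finset.mem_singleton]
      rintro x (rfl | rfl | rfl) <;> simp [hplow, hrup, hsup]
  · refine ⟨{(p, true), (q, true), (r, false)}, ?_, ?_, ?_⟩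
    · simp [Finset.insert_subset_iff, hp, hq, hr]
    · rw [Finset.card_eq_three.2 ⟨_, _, _, ?_, ?_, ?_, rfl⟩] <;> simp [hpq]
    · simp only [Finset.mem_insert, Finset.mem_singleton]
      rintro x (rfl | rfl | rfl) <;> simp [hplow, hqlow, hrup]

/-- **Melchior's inequality** for an arrangement of lines with distinct slopes, not all passing
through one point. -/
theorem melchior (ha : Function.Injective a) (hc : ∀ v, ∃ i, i ∉ linesThrough a b v) :
    ∑ v ∈ crossings a b, (linesThrough a b v).card + 3 ≤ 3 * (crossings a b).card := by
  classical
  let T : (ℝ × ℝ) → Finset ι := fun v =>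
    (linesThrough a b v).filter fun j => ∃ k ∈ linesThrough a b v, a k < a j
  have hT (v : ℝ × ℝ) (hv : v ∈ crossings a b) : (linesThrough a b v).card ≤ (T v).card + 1 := by
    obtain ⟨i, -, -, hi, -⟩ := (mem_crossings ha).1 hv
    obtain ⟨k, hk, hmin⟩ := (linesThrough a b v).exists_min_image a ⟨i, hi⟩
    refine (Finset.card_le_card fun j hj => ?_).trans (Finset.card_insert_le k (T v))
    rw [Finset.mem_insert, or_iff_not_imp_left]
    exact fun hjk => Finset.mem_filter.2 ⟨hj, k, hk, (hmin j hj).lt_of_ne fun h => hjk (ha h.symm)⟩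
  obtain ⟨M, hM, hM3, hMout⟩ := three_le_card_envelope (b := b) ha hc
  have key : ((crossings a b).sigma T).card ≤
      ((crossings a b ×ˢ (Finset.univ : Finset Bool)) \ M).card := by
    refine Finset.card_le_card_of_forall_subsingleton
      (fun x y => ∃ i, IsPred a b x.1 i x.2 ∧ SectorMeets a b x.1 i x.2 y.1 y.2) ?_ ?_
    · rintro ⟨v, j⟩ hx
      simp only [T, Finset.mem_sigma, Finset.mem_filter] at hx
      obtain ⟨hv, hj, k, hk, hkj⟩ := hx
      obtain ⟨i, hp⟩ := exists_isPred hj hk hkj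
      obtain ⟨w, hw, c, h⟩ := exists_sectorMeets ha hc hv hp
      refine ⟨(w, c), ?_, i, hp, h⟩
      simp only [Finset.mem_sdiff, Finset.mem_product, hw, Finset.mem_univ, and_self, true_and]
      intro hmem
      cases c with
      | true =>
        obtain ⟨k, hk⟩ := h.exists_below hp
        exact ((hMout _ hmem).1 rfl k).not_gt hk
      | false =>
        obtain ⟨k, hk⟩ := h.exists_above hp
        exact ((hMout _ hmem).2 rfl k).not_gt hk
    · rintro ⟨w, c⟩ - ⟨v, j⟩ ⟨hx, i, hp, h⟩ ⟨v', j'⟩ ⟨hx', i', hp', h'⟩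
      simp only [Finset.mem_sigma] at hx hx'
      obtain ⟨rfl, rfl⟩ := h.unique ha hx.1 hx'.1 hp hp' h'
      rfl
  rw [Finset.card_sigma, Finset.card_sdiff_of_subset hM, Finset.card_product] at key
  have hle := Finset.card_le_card hM
  rw [Finset.card_product] at hle
  have hsum := Finset.sum_le_sum hT
  rw [Finset.sum_add_distrib] at hsum
  simp only [Finset.card_univ, Fintype.card_bool, Finset.sum_const, smul_eq_mul] at *
  omega

end Melchior

section Planes

theorem range_triple {α : Type*} (p q r : α) : Set.range ![p, q, r] = {p, q, r} := by
  ext x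
  simp only [Matrix.range_cons, Matrix.range_empty, Set.mem_union, Set.mem_insert_iff,
    Set.mem_singleton_iff, Set.mem_empty_iff_false, or_false]

theorem affineSpan_triple_eq {sp : AffineSubspace ℝ Pt3} {p q r : Pt3}
    (h : AffineIndependent ℝ ![p, q, r]) (hsp : Module.finrank ℝ sp.direction = 2)
    (hp : p ∈ sp) (hq : q ∈ sp) (hr : r ∈ sp) : affineSpan ℝ {p, q, r} = sp := by
  rw [← range_triple]
  refine h.affineSpan_eq_of_le_of_card_eq_finrank_add_one ?_ (by simp [hsp])
  rw [range_triple, affineSpan_le]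
  rintro x (rfl | rfl | rfl) <;> assumption

theorem IsPlane.eq_affineSpan {P : Set Pt3} (hP : IsPlane P) {p q r : Pt3}
    (h : AffineIndependent ℝ ![p, q, r]) (hp : p ∈ P) (hq : q ∈ P) (hr : r ∈ P) :
    P = affineSpan ℝ {p, q, r} := by
  obtain ⟨a, b, c, habc, rfl⟩ := hP
  rw [affineSpan_triple_eq h ?_ hp hq hr]
  rw [direction_affineSpan, ← range_triple]
  exact habc.finrank_vectorSpan (by simp)

theorem affineSpan_eq_zeros {φ : Pt3 →ₗ[ℝ] ℝ} (hφ : φ ≠ 0) {p q r : Pt3}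
    (h : AffineIndependent ℝ ![p, q, r]) (hq : φ (q - p) = 0) (hr : φ (r - p) = 0) :
    (affineSpan ℝ {p, q, r} : Set Pt3) = {x | φ (x - p) = 0} := by
  rw [affineSpan_triple_eq (sp := AffineSubspace.mk' p φ.ker) h]
  · ext x; simp [AffineSubspace.mem_mk']
  · rw [AffineSubspace.direction_mk']
    have := Module.Dual.finrank_ker_add_one_of_ne_zero hφ
    simp only [finrank_euclideanSpace, Fintype.card_fin] at this
    omega
  all_goals simp [AffineSubspace.mem_mk', hq, hr]

theorem coplanar_of_subset_zeros {φ : Pt3 →ₗ[ℝ] ℝ} (hφ : φ ≠ 0) {p : Pt3} {S : Set Pt3}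
    (h : ∀ x ∈ S, φ (x - p) = 0) : Coplanar ℝ S := by
  have hle : vectorSpan ℝ S ≤ φ.ker := by
    rw [vectorSpan_def, Submodule.span_le]
    rintro _ ⟨x, hx, y, hy, rfl⟩
    have : x - y = (x - p) - (y - p) := by abel
    simp [this, h x hx, h y hy, -sub_sub_sub_cancel_right]
  rw [coplanar_iff_finrank_le_two]
  have := Module.Dual.finrank_ker_add_one_of_ne_zero hφ
  simp only [finrank_euclideanSpace, Fintype.card_fin] at this
  have := Submodule.finrank_mono hle
  omega

theorem NoThreeCollinear.affineIndependent {S : Set Pt3} (h3 : NoThreeCollinear S) {p q r : Pt3}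
    (hp : p ∈ S) (hq : q ∈ S) (hr : r ∈ S) (hpq : p ≠ q) (hpr : p ≠ r) (hqr : q ≠ r) :
    AffineIndependent ℝ ![p, q, r] := by
  rw [affineIndependent_iff_not_collinear_set]
  refine h3 _ ?_ (Set.ncard_eq_three.2 ⟨p, q, r, hpq, hpr, hqr, rfl⟩)
  rintro x (rfl | rfl | rfl) <;> assumption

theorem eq_of_inter_eq {S : Set Pt3} (hS : S.Finite) (h3 : NoThreeCollinear S) {P Q : Set Pt3}
    (hP : P ∈ detPlanes S) (hQ : Q ∈ detPlanes S) (h : S ∩ P = S ∩ Q) : P = Q := by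
  obtain ⟨x, y, z, hx, hy, hz, hxy, hxz, hyz⟩ :=
    (Set.two_lt_ncard_iff (hS.inter_of_left P)).1 hP.2
  have hi := h3.affineIndependent hx.1 hy.1 hz.1 hxy hxz hyz
  rw [hP.1.eq_affineSpan hi hx.2 hy.2 hz.2]
  rw [h] at hx hy hz
  rw [hQ.1.eq_affineSpan hi hx.2 hy.2 hz.2]

theorem finite_detPlanes {S : Set Pt3} (hS : S.Finite) (h3 : NoThreeCollinear S) :
    (detPlanes S).Finite :=
  Set.Finite.of_injOn (f := fun P => S ∩ P) (t := 𝒫 S) (fun _ _ => Set.inter_subset_left)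
    (fun _ hP _ hQ h => eq_of_inter_eq hS h3 hP hQ h) hS.finite_subsets

theorem finite_roots_quadratic {c₀ c₁ c₂ : ℝ} (h : ¬ (c₀ = 0 ∧ c₁ = 0 ∧ c₂ = 0)) :
    {s : ℝ | c₀ + s * c₁ + s ^ 2 * c₂ = 0}.Finite := by
  open Polynomial in
  have hp : (C c₀ + C c₁ * X + C c₂ * X ^ 2 : ℝ[X]) ≠ 0 := by
    intro h0
    refine h ⟨?_, ?_, ?_⟩
    · simpa [coeff_X, coeff_C] using congrArg (fun p => coeff p 0) h0
    · simpa [coeff_X, coeff_C] using congrArg (fun p => coeff p 1) h0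
    · simpa [coeff_X, coeff_C] using congrArg (fun p => coeff p 2) h0
  refine (Polynomial.finite_setOfPred_isRoot hp).subset fun s hs => ?_
  simp only [Set.mem_ofPred_eq, Polynomial.IsRoot.def, Polynomial.eval_add, Polynomial.eval_mul,
    Polynomial.eval_C, Polynomial.eval_X, Polynomial.eval_pow] at hs ⊢
  linarith

theorem collinear_of_minors_eq_zero {p q r : Pt3} (hpq : q ≠ p)
    (h01 : (q - p) 0 * (r - p) 1 = (q - p) 1 * (r - p) 0)
    (h02 : (q - p) 0 * (r - p) 2 = (q - p) 2 * (r - p) 0)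
    (h12 : (q - p) 1 * (r - p) 2 = (q - p) 2 * (r - p) 1) : Collinear ℝ {p, q, r} := by
  suffices ∃ c : ℝ, r - p = c • (q - p) by
    obtain ⟨c, hc⟩ := this
    refine (collinear_iff_of_mem (p₀ := p) (by simp)).2 ⟨q - p, ?_⟩
    rintro x (rfl | rfl | rfl)
    · exact ⟨0, by simp⟩
    · exact ⟨1, by simp⟩
    · exact ⟨c, by simp [← hc]⟩
  obtain ⟨k, hk⟩ : ∃ k, (q - p) k ≠ 0 := by
    by_contra! h
    exact hpq (sub_eq_zero.1 (by ext k; simpa using h k))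
  generalize q - p = u at *
  generalize r - p = w at *
  refine ⟨w k / u k, ?_⟩
  ext l
  rw [PiLp.smul_apply, smul_eq_mul, div_mul_eq_mul_div, eq_div_iff hk]
  fin_cases k <;> fin_cases l <;> simp only [Fin.zero_eta, Fin.mk_one, Fin.reduceFinMk] <;> linarith

/-- Coordinates in which the points of `S` other than `p` give lines of distinct slopes. -/
theorem exists_generic_coordinates {S : Set Pt3} (hS : S.Finite) (h3 : NoThreeCollinear S)
    {p : Pt3} (hp : p ∈ S) :
    ∃ f g h : Pt3 →ₗ[ℝ] ℝ, (∀ t y : ℝ, t • g + h - y • f ≠ 0) ∧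
      (∀ q ∈ S, q ≠ p → f (q - p) ≠ 0) ∧
      ∀ q ∈ S, ∀ r ∈ S, q ≠ p → r ≠ p → q ≠ r →
        g (q - p) * f (r - p) ≠ g (r - p) * f (q - p) := by
  let e (i : Fin 3) : Pt3 →ₗ[ℝ] ℝ := (EuclideanSpace.proj (𝕜 := ℝ) i).toLinearMap
  have he (i : Fin 3) (x : Pt3) : e i x = x i := rfl
  have hfin1 : (⋃ q ∈ S \ {p}, {s : ℝ | (q - p) 0 + s * (q - p) 1 + s ^ 2 * (q - p) 2 = 0}).Finite
      := by
    refine hS.sdiff.biUnion fun q hq => finite_roots_quadratic ?_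
    rintro ⟨h0, h1, h2⟩
    refine hq.2 (sub_eq_zero.1 ?_)
    ext k
    fin_cases k <;> assumption
  have hfin2 : (⋃ x ∈ {x ∈ S ×ˢ S | x.1 ≠ p ∧ x.2 ≠ p ∧ x.1 ≠ x.2}, {s : ℝ |
      ((x.1 - p) 0 * (x.2 - p) 1 - (x.1 - p) 1 * (x.2 - p) 0) +
      s * (2 * ((x.1 - p) 0 * (x.2 - p) 2 - (x.1 - p) 2 * (x.2 - p) 0)) +
      s ^ 2 * ((x.1 - p) 1 * (x.2 - p) 2 - (x.1 - p) 2 * (x.2 - p) 1) = 0}).Finite := by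
    refine ((hS.prod hS).subset (Set.sep_subset _ _)).biUnion ?_
    rintro ⟨q, r⟩ ⟨⟨hq, hr⟩, hqp, hrp, hqr⟩
    refine finite_roots_quadratic ?_
    rintro ⟨h0, h1, h2⟩
    exact affineIndependent_iff_not_collinear_set.1
      (h3.affineIndependent hp hq hr hqp.symm hrp.symm hqr)
      (collinear_of_minors_eq_zero hqp (by linarith) (by linarith) (by linarith))
  obtain ⟨s, hs⟩ := (hfin1.union hfin2).infinite_compl.nonempty
  simp only [Set.mem_compl_iff, Set.mem_union, Set.mem_iUnion, not_or, not_exists] at hs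
  refine ⟨e 0 + s • e 1 + s ^ 2 • e 2, e 1 + (2 * s) • e 2, e 2, ?_, ?_, ?_⟩
  · intro t y h
    have h0 := LinearMap.congr_fun h (EuclideanSpace.single 0 1)
    have h1 := LinearMap.congr_fun h (EuclideanSpace.single 1 1)
    have h2 := LinearMap.congr_fun h (EuclideanSpace.single 2 1)
    simp [he] at h0 h1 h2
    subst h0
    simp at h1
    subst h1
    simp at h2
  · intro q hq hqp h
    exact hs.1 q ⟨hq, hqp⟩ (by simpa [he] using h)
  · intro q hq r hr hqp hrp hqr h
    refine hs.2 (q, r) ⟨⟨hq, hr⟩, hqp, hrp, hqr⟩ ?_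
    simp only [LinearMap.add_apply, LinearMap.smul_apply, he, smul_eq_mul] at h
    simp only [Set.mem_ofPred_eq]
    linarith

/-- Melchior's inequality for the planes determined by `S` that pass through a point of `S`. -/
theorem melchior_through_point {S : Set Pt3} (hS : S.Finite) (h3 : NoThreeCollinear S)
    (hpl : ¬ Coplanar ℝ S) {D : Finset (Set Pt3)} {p : Pt3} (hp : p ∈ S)
    (hD : ∀ P, P ∈ D ↔ P ∈ detPlanes S ∧ p ∈ P) :
    ∑ P ∈ D, (S ∩ P).ncard + 3 ≤ 4 * D.card := by
  classical
  obtain ⟨f, g, h, hne, hf, hfg⟩ := exists_generic_coordinates hS h3 hp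
  have : Fintype ↥(S \ {p}) := hS.sdiff.fintype
  let a : ↥(S \ {p}) → ℝ := fun q => g (q - p) / f (q - p)
  let b : ↥(S \ {p}) → ℝ := fun q => h (q - p) / f (q - p)
  have hf' (q : ↥(S \ {p})) : f (q - p) ≠ 0 := hf q q.2.1 q.2.2
  have ha : Function.Injective a := fun q r hqr => by
    by_contra hne
    exact hfg q q.2.1 r r.2.1 q.2.2 r.2.2 (fun h => hne (Subtype.ext h))
      ((div_eq_div_iff (hf' q) (hf' r)).1 hqr)
  let φ (v : ℝ × ℝ) : Pt3 →ₗ[ℝ] ℝ := v.1 • g + h - v.2 • f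
  have hφ (v : ℝ × ℝ) (q : ↥(S \ {p})) : q ∈ linesThrough a b v ↔ φ v (q - p) = 0 := by
    rw [mem_linesThrough]
    have := hf' q
    simp only [a, b, φ, LinearMap.sub_apply, LinearMap.add_apply, LinearMap.smul_apply,
      smul_eq_mul]
    rw [div_mul_eq_mul_div, ← add_div, div_eq_iff this, sub_eq_zero, mul_comm v.1]
  have hc (v : ℝ × ℝ) : ∃ q, q ∉ linesThrough a b v := by
    by_contra! hall
    refine hpl (coplanar_of_subset_zeros (hne v.1 v.2) (p := p) fun x hx => ?_)
    by_cases hxp : x = p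
    · simp [hxp]
    · exact (hφ v ⟨x, hx, hxp⟩).1 (hall _)
  let pl (v : ℝ × ℝ) : Set Pt3 := {x | φ v (x - p) = 0}
  have hpl_eq {v : ℝ × ℝ} {q r : ↥(S \ {p})} (hqr : q ≠ r) (hq : q ∈ linesThrough a b v)
      (hr : r ∈ linesThrough a b v) :
      AffineIndependent ℝ ![p, (q : Pt3), (r : Pt3)] ∧
        pl v = affineSpan ℝ {p, (q : Pt3), (r : Pt3)} := by
    have hi := h3.affineIndependent hp q.2.1 r.2.1 (Ne.symm q.2.2) (Ne.symm r.2.2)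
      (fun h => hqr (Subtype.ext h))
    exact ⟨hi, (affineSpan_eq_zeros (hne v.1 v.2) hi ((hφ v q).1 hq) ((hφ v r).1 hr)).symm⟩
  have hcard (v : ℝ × ℝ) : (S ∩ pl v).ncard = (linesThrough a b v).card + 1 := by
    have : S ∩ pl v = insert p (Subtype.val '' (linesThrough a b v : Set ↥(S \ {p}))) := by
      ext x
      simp only [Set.mem_inter_iff, Set.mem_insert_iff, Set.mem_image, Finset.mem_coe]
      constructor
      · rintro ⟨hx, hxv⟩
        by_cases hxp : x = p
        · exact .inl hxp
        · exact .inr ⟨⟨x, hx, hxp⟩, (hφ v _).2 hxv, rfl⟩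
      · rintro (rfl | ⟨q, hq, rfl⟩)
        · exact ⟨hp, by simp [pl]⟩
        · exact ⟨q.2.1, (hφ v q).1 hq⟩
    rw [this, Set.ncard_insert_of_notMem, Set.ncard_image_of_injective _ Subtype.val_injective,
      Set.ncard_coe_finset]
    rintro ⟨q, -, hq⟩
    exact q.2.2 hq
  have hinj : Set.InjOn pl (crossings a b) := fun v hv w hw hvw => by
    obtain ⟨q, r, hqr, hq, hr⟩ := (mem_crossings ha).1 hv
    have mem {q} (hq : q ∈ linesThrough a b v) : q ∈ linesThrough a b w := by
      rw [hφ] at hq ⊢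
      exact (Set.ext_iff.1 hvw q).1 hq
    exact crossing_unique ha hqr hq hr (mem hq) (mem hr)
  have himage : (crossings a b).image pl = D := by
    ext P
    rw [Finset.mem_image, hD]
    constructor
    · rintro ⟨v, hv, rfl⟩
      obtain ⟨q, r, hqr, hq, hr⟩ := (mem_crossings ha).1 hv
      refine ⟨⟨⟨p, q, r, hpl_eq hqr hq hr⟩, ?_⟩, by simp [pl]⟩
      rw [hcard]
      have : 1 < (linesThrough a b v).card := Finset.one_lt_card.2 ⟨q, hq, r, hr, hqr⟩
      omega
    · rintro ⟨⟨hP, hP3⟩, hpP⟩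
      have hfin := hS.inter_of_left P
      have : 1 < ((S ∩ P) \ {p}).ncard := by
        rw [Set.ncard_sdiff_singleton_of_mem (show p ∈ S ∩ P from ⟨hp, hpP⟩)]
        omega
      obtain ⟨q, r, hq, hr, hqr⟩ := (Set.one_lt_ncard_iff hfin.sdiff).1 this
      have hqr' : (⟨q, hq.1.1, hq.2⟩ : ↥(S \ {p})) ≠ (⟨r, hr.1.1, hr.2⟩ : ↥(S \ {p})) :=
        fun h => hqr (congrArg Subtype.val h)
      obtain ⟨v, hv, hqv, hrv⟩ := exists_crossing (b := b) ha hqr'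
      obtain ⟨hi, heq⟩ := hpl_eq hqr' hqv hrv
      exact ⟨v, hv, heq.trans (hP.eq_affineSpan hi hpP hq.1.2 hr.1.2).symm⟩
  have := melchior (b := b) ha hc
  rw [← himage, Finset.sum_image hinj, Finset.card_image_of_injOn hinj]
  simp only [hcard, Finset.sum_add_distrib, Finset.sum_const, smul_eq_mul]
  omega

end Planes

theorem stmt11 (S : Set Pt3) (hS : S.Finite) (n : ℕ) (hn : S.ncard = n)
    (h3 : NoThreeCollinear S) (hpl : ¬ Coplanar ℝ S) :
    6 * (detPlanes S).ncard ≥ 3 * n + ∑ k ∈ Finset.Icc 3 n, k.choose 2 * planeCount S k := by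
  classical
  have hfin := finite_detPlanes hS h3
  set D := hfin.toFinset with hD
  have hsum : ∑ k ∈ Finset.Icc 3 n, k.choose 2 * planeCount S k =
      ∑ P ∈ D, (S ∩ P).ncard.choose 2 := by
    rw [← Finset.sum_fiberwise_of_maps_to (s := D) (t := Finset.Icc 3 n)
      (g := fun P => (S ∩ P).ncard)]
    · refine Finset.sum_congr rfl fun k hk => ?_
      rw [Finset.sum_congr rfl fun P hP => by rw [(Finset.mem_filter.1 hP).2], Finset.sum_const,
        smul_eq_mul, mul_comm, planeCount, ← Set.ncard_coe_finset]
      congr 2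
      ext P
      simp only [hD, detPlanes, Finset.coe_filter, Set.Finite.mem_toFinset, Set.mem_ofPred_eq]
      have := (Finset.mem_Icc.1 hk).1
      constructor
      · rintro ⟨h, h'⟩; exact ⟨⟨h, by omega⟩, h'⟩
      · rintro ⟨⟨h, -⟩, h'⟩; exact ⟨h, h'⟩
    · intro P hP
      rw [hD, Set.Finite.mem_toFinset] at hP
      exact Finset.mem_Icc.2 ⟨hP.2, hn ▸ Set.ncard_le_ncard Set.inter_subset_left hS⟩
  have hpt (p) (hp : p ∈ hS.toFinset) : ∑ P ∈ D with p ∈ P, (S ∩ P).ncard + 3 ≤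
      ∑ P ∈ D with p ∈ P, 4 := by
    rw [Finset.sum_const, smul_eq_mul, mul_comm]
    exact melchior_through_point hS h3 hpl (hS.mem_toFinset.1 hp) fun P => by simp [hD]
  have hdouble (w : Set Pt3 → ℕ) : ∑ p ∈ hS.toFinset, ∑ P ∈ D with p ∈ P, w P =
      ∑ P ∈ D, (S ∩ P).ncard * w P := by
    rw [Finset.sum_comm' (t' := D) (s' := fun P => hS.toFinset.filter fun p => p ∈ P)
      (by intro p P; simp only [Finset.mem_filter]; tauto)]
    refine Finset.sum_congr rfl fun P _ => ?_
    rw [Finset.sum_const, smul_eq_mul, ← Set.ncard_coe_finset]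
    congr 2
    ext p
    simp
  have htotal := Finset.sum_le_sum hpt
  rw [Finset.sum_add_distrib, hdouble, hdouble, Finset.sum_const, smul_eq_mul,
    ← Set.ncard_eq_toFinset_card S hS, hn] at htotal
  have hlocal : ∑ P ∈ D, ((S ∩ P).ncard.choose 2 + (S ∩ P).ncard * 4) ≤
      ∑ P ∈ D, (6 + (S ∩ P).ncard * (S ∩ P).ncard) := by
    refine Finset.sum_le_sum fun P hP => ?_
    rw [hD, Set.Finite.mem_toFinset] at hP
    have hk := hP.2
    generalize (S ∩ P).ncard = k at hk
    obtain ⟨j, rfl⟩ := Nat.exists_eq_add_of_le' hk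
    have h2 : (j + 3).choose 2 * 2 = (j + 3) * (j + 2) := by
      rw [Nat.choose_two_right, Nat.div_mul_cancel (Nat.even_mul_pred_self _).two_dvd]
      rfl
    have hj : j ≤ j * j := Nat.le_mul_self j
    nlinarith
  simp only [Finset.sum_add_distrib, Finset.sum_const, smul_eq_mul] at hlocal
  rw [hsum, Set.ncard_eq_toFinset_card _ hfin, ← hD]
  omega
end
end

section
/- Let S be a finite set of points in ℝ³, no three collinear, with exactly r points on a plane π and exactly s points not on π. Then the number of planes containing exactly three points of S satisfies m₃ ≥ s·C(r,2) − (1/2)·r·s·(s−1) (as an inequality of real numbers). -/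
open Set

noncomputable section

theorem IsPlane.eq_affineSpan_s13 {X : Set Pt3} (hX : IsPlane X) {a b c : Pt3}
    (h : ¬ Collinear ℝ ({a, b, c} : Set Pt3)) (ha : a ∈ X) (hb : b ∈ X) (hc : c ∈ X) :
    X = (affineSpan ℝ ({a, b, c} : Set Pt3) : Set Pt3) := by
  obtain ⟨u, v, w, hi, rfl⟩ := hX
  rw [← affineIndependent_iff_not_collinear_set] at h
  have hr : ∀ x y z : Pt3, ({x, y, z} : Set Pt3) = Set.range ![x, y, z] := by
    intro x y z
    rw [Matrix.range_cons, Matrix.range_cons_cons_empty, Set.singleton_union]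
  have hfr : Module.finrank ℝ (affineSpan ℝ ({u, v, w} : Set Pt3)).direction = 2 := by
    rw [direction_affineSpan, hr]
    exact hi.finrank_vectorSpan (by simp)
  have : affineSpan ℝ (Set.range ![a, b, c]) = affineSpan ℝ ({u, v, w} : Set Pt3) := by
    apply h.affineSpan_eq_of_le_of_card_eq_finrank_add_one
    · rw [affineSpan_le, ← hr]
      rintro x (rfl | rfl | rfl) <;> assumption
    · rw [hfr]; simp
  rw [hr a b c, this]

theorem NoThreeCollinear.not_collinear {S : Set Pt3} (h3 : NoThreeCollinear S) {a b c : Pt3}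
    (ha : a ∈ S) (hb : b ∈ S) (hc : c ∈ S) (hab : a ≠ b) (hac : a ≠ c) (hbc : b ≠ c) :
    ¬ Collinear ℝ ({a, b, c} : Set Pt3) := by
  apply h3
  · rintro x (rfl | rfl | rfl) <;> assumption
  · exact Set.ncard_eq_three.2 ⟨a, b, c, hab, hac, hbc, rfl⟩

/-- Two planes sharing three distinct points of a set without collinear triples coincide. -/
theorem NoThreeCollinear.plane_unique {S : Set Pt3} (h3 : NoThreeCollinear S) {X Y : Set Pt3}
    (hX : IsPlane X) (hY : IsPlane Y) {a b c : Pt3}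
    (ha : a ∈ S) (hb : b ∈ S) (hc : c ∈ S) (hab : a ≠ b) (hac : a ≠ c) (hbc : b ≠ c)
    (haX : a ∈ X) (hbX : b ∈ X) (hcX : c ∈ X) (haY : a ∈ Y) (hbY : b ∈ Y) (hcY : c ∈ Y) :
    X = Y := by
  have h := h3.not_collinear ha hb hc hab hac hbc
  rw [hX.eq_affineSpan_s13 h haX hbX hcX, hY.eq_affineSpan_s13 h haY hbY hcY]

/-- The plane through three points, as a set. -/
def planeThrough (a b c : Pt3) : Set Pt3 := (affineSpan ℝ ({a, b, c} : Set Pt3) : Set Pt3)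

theorem left_mem_planeThrough (a b c : Pt3) : a ∈ planeThrough a b c :=
  subset_affineSpan ℝ _ (by simp)

theorem mid_mem_planeThrough (a b c : Pt3) : b ∈ planeThrough a b c :=
  subset_affineSpan ℝ _ (by simp)

theorem right_mem_planeThrough (a b c : Pt3) : c ∈ planeThrough a b c :=
  subset_affineSpan ℝ _ (by simp)

theorem NoThreeCollinear.isPlane_planeThrough {S : Set Pt3} (h3 : NoThreeCollinear S) {a b c : Pt3}
    (ha : a ∈ S) (hb : b ∈ S) (hc : c ∈ S) (hab : a ≠ b) (hac : a ≠ c) (hbc : b ≠ c) :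
    IsPlane (planeThrough a b c) :=
  ⟨a, b, c, affineIndependent_iff_not_collinear_set.2 (h3.not_collinear ha hb hc hab hac hbc), rfl⟩

theorem NoThreeCollinear.finite_threePointPlanes {S : Set Pt3} (hS : S.Finite)
    (h3 : NoThreeCollinear S) : {X : Set Pt3 | IsPlane X ∧ (S ∩ X).ncard = 3}.Finite := by
  apply Set.Finite.of_finite_image (f := fun X => S ∩ X)
  · exact hS.finite_subsets.subset (by rintro _ ⟨X, -, rfl⟩; exact Set.inter_subset_left)
  · rintro X ⟨hX, hX3⟩ Y ⟨hY, -⟩ (hXY : S ∩ X = S ∩ Y)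
    obtain ⟨a, b, c, hab, hac, hbc, h⟩ := Set.ncard_eq_three.1 hX3
    have ha : a ∈ S ∩ X := by rw [h]; simp
    have hb : b ∈ S ∩ X := by rw [h]; simp
    have hc : c ∈ S ∩ X := by rw [h]; simp
    have ha' := hXY ▸ ha
    have hb' := hXY ▸ hb
    have hc' := hXY ▸ hc
    exact h3.plane_unique hX hY ha.1 hb.1 hc.1 hab hac hbc ha.2 hb.2 hc.2 ha'.2 hb'.2 hc'.2

/-- A plane through two points of `S` on `P` and a point off `P` contains no further point
of `S` on `P`. -/
theorem NoThreeCollinear.eq_or_eq_of_mem_inter {S : Set Pt3} (h3 : NoThreeCollinear S)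
    {P X : Set Pt3} (hP : IsPlane P) (hX : IsPlane X) {q a b x : Pt3} (hqX : q ∈ X) (hqP : q ∉ P)
    (ha : a ∈ S ∩ P) (hb : b ∈ S ∩ P) (hx : x ∈ S ∩ P) (hab : a ≠ b)
    (haX : a ∈ X) (hbX : b ∈ X) (hxX : x ∈ X) : x = a ∨ x = b := by
  by_contra! h
  exact hqP (h3.plane_unique hX hP ha.1 hb.1 hx.1 hab h.1.symm h.2.symm
    haX hbX hxX ha.2 hb.2 hx.2 ▸ hqX)

open Classical in
theorem NoThreeCollinear.card_triples_le {S : Set Pt3} (hS : S.Finite) (h3 : NoThreeCollinear S)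
    {P : Set Pt3} (hP : IsPlane P) {A Q : Finset Pt3} (hA : (A : Set Pt3) = S ∩ P)
    (hQ : (Q : Set Pt3) = S \ P) :
    (Q ×ˢ A.offDiag).card ≤ 2 * planeCount S 3 + (Q.offDiag ×ˢ A).card := by
  have mA : ∀ x, x ∈ A ↔ x ∈ S ∩ P := fun x => by rw [← hA, Finset.mem_coe]
  have mQ : ∀ x, x ∈ Q ↔ x ∈ S \ P := fun x => by rw [← hQ, Finset.mem_coe]
  let f : Pt3 × Pt3 × Pt3 → Set Pt3 := fun t => planeThrough t.1 t.2.1 t.2.2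
  have hne : ∀ {x y : Pt3}, x ∈ S \ P → y ∈ S ∩ P → x ≠ y := by
    rintro x y hx hy rfl
    exact hx.2 hy.2
  have hpl : ∀ {q a b : Pt3}, q ∈ S \ P → a ∈ S ∩ P → b ∈ S ∩ P → a ≠ b →
      IsPlane (planeThrough q a b) := fun hq ha hb hab =>
    h3.isPlane_planeThrough hq.1 ha.1 hb.1 (hne hq ha) (hne hq hb) hab
  rw [← Finset.card_filter_add_card_filter_not (s := Q ×ˢ A.offDiag)
    (fun t => (S ∩ f t).ncard = 3)]
  apply add_le_add
  · have hfin := h3.finite_threePointPlanes hS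
    rw [planeCount, Set.ncard_eq_toFinset_card _ hfin]
    refine Finset.card_le_mul_card_image_of_maps_to (f := f) ?_ 2 ?_
    · rintro ⟨q, a, b⟩ h
      simp only [Finset.mem_filter, Finset.mem_product, Finset.mem_offDiag, mA, mQ] at h
      obtain ⟨⟨hq, ha, hb, hab⟩, hn⟩ := h
      simpa using ⟨hpl hq ha hb hab, hn⟩
    · intro X hX
      rw [Set.Finite.mem_toFinset] at hX
      obtain ⟨hX, hn⟩ := hX
      rw [Finset.filter_filter]
      rcases Finset.eq_empty_or_nonempty
        ({t ∈ Q ×ˢ A.offDiag | (S ∩ f t).ncard = 3 ∧ f t = X}) with h0 | ⟨⟨q, a, b⟩, h⟩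
      · rw [h0]; simp
      · simp only [Finset.mem_filter, Finset.mem_product, Finset.mem_offDiag, mA, mQ] at h
        obtain ⟨⟨hq, ha, hb, hab⟩, -, rfl⟩ := h
        have hSX : {q, a, b} = S ∩ f (q, a, b) := by
          apply Set.eq_of_subset_of_ncard_le
          · rintro x (rfl | rfl | rfl)
            · exact ⟨hq.1, left_mem_planeThrough _ _ _⟩
            · exact ⟨ha.1, mid_mem_planeThrough _ _ _⟩
            · exact ⟨hb.1, right_mem_planeThrough _ _ _⟩
          · rw [hn, Set.ncard_eq_three.2 ⟨q, a, b, hne hq ha, hne hq hb, hab, rfl⟩]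
          · exact hS.subset Set.inter_subset_left
        refine (Finset.card_le_card (t := {(q, a, b), (q, b, a)}) ?_).trans Finset.card_le_two
        rintro ⟨q', a', b'⟩ h
        simp only [Finset.mem_filter, Finset.mem_product, Finset.mem_offDiag, mA, mQ] at h
        obtain ⟨⟨hq', ha', hb', hab'⟩, -, he⟩ := h
        have hq1 : q' ∈ ({q, a, b} : Set Pt3) := by
          rw [hSX, ← he]; exact ⟨hq'.1, left_mem_planeThrough _ _ _⟩
        have ha1 : a' ∈ ({q, a, b} : Set Pt3) := by
          rw [hSX, ← he]; exact ⟨ha'.1, mid_mem_planeThrough _ _ _⟩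
        have hb1 : b' ∈ ({q, a, b} : Set Pt3) := by
          rw [hSX, ← he]; exact ⟨hb'.1, right_mem_planeThrough _ _ _⟩
        have := hne hq' ha
        have := hne hq' hb
        have := hne hq ha'
        have := hne hq hb'
        simp only [Set.mem_insert_iff, Set.mem_singleton_iff] at hq1 ha1 hb1
        simp only [Finset.mem_insert, Finset.mem_singleton, Prod.mk.injEq]
        grind
  · have hex : ∀ t : Pt3 × Pt3 × Pt3, ∃ x, t ∈ Q ×ˢ A.offDiag → (S ∩ f t).ncard ≠ 3 →
        x ∈ S \ P ∧ x ≠ t.1 ∧ x ∈ f t := by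
      rintro ⟨q, a, b⟩
      by_contra! hcon
      obtain ⟨h, hn, -⟩ := hcon q
      simp only [Finset.mem_product, Finset.mem_offDiag, mA, mQ] at h
      obtain ⟨hq, ha, hb, hab⟩ := h
      refine hn (Set.ncard_eq_three.2 ⟨q, a, b, hne hq ha, hne hq hb, hab, ?_⟩)
      apply Set.Subset.antisymm
      · rintro x ⟨hxS, hxf⟩
        by_cases hxP : x ∈ P
        · exact Or.inr (h3.eq_or_eq_of_mem_inter hP (hpl hq ha hb hab)
            (left_mem_planeThrough _ _ _) hq.2 ha hb ⟨hxS, hxP⟩ hab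
            (mid_mem_planeThrough _ _ _) (right_mem_planeThrough _ _ _) hxf)
        · by_contra hx
          exact (hcon x).2.2 ⟨hxS, hxP⟩ (fun e => hx (Or.inl e)) hxf
      · rintro x (rfl | rfl | rfl)
        · exact ⟨hq.1, left_mem_planeThrough _ _ _⟩
        · exact ⟨ha.1, mid_mem_planeThrough _ _ _⟩
        · exact ⟨hb.1, right_mem_planeThrough _ _ _⟩
    choose g hg using hex
    refine Finset.card_le_card_of_injOn (fun t => ((t.1, g t), t.2.1)) ?_ ?_
    · rintro ⟨q, a, b⟩ h
      obtain ⟨h, hn⟩ := Finset.mem_filter.1 (Finset.mem_coe.1 h)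
      obtain ⟨hx, hxq, -⟩ := hg _ h hn
      simp only [Finset.mem_product, Finset.mem_offDiag] at h
      simp only [Finset.coe_product, Set.mem_prod, Finset.mem_coe, Finset.mem_offDiag]
      exact ⟨⟨h.1, (mQ _).2 hx, hxq.symm⟩, h.2.1⟩
    · rintro ⟨q, a, b⟩ h ⟨q', a', b'⟩ h' he
      obtain ⟨h, hn⟩ := Finset.mem_filter.1 (Finset.mem_coe.1 h)
      obtain ⟨h', hn'⟩ := Finset.mem_filter.1 (Finset.mem_coe.1 h')
      obtain ⟨hx, hxq, hxf⟩ := hg _ h hn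
      obtain ⟨-, -, hxf'⟩ := hg _ h' hn'
      simp only [Prod.mk.injEq] at he
      obtain ⟨⟨rfl, hgg⟩, rfl⟩ := he
      rw [← hgg] at hxf'
      simp only [Finset.mem_product, Finset.mem_offDiag, mA, mQ] at h h'
      obtain ⟨hq, ha, hb, hab⟩ := h
      obtain ⟨-, -, hb', hab'⟩ := h'
      have hpp : planeThrough q a b = planeThrough q a b' :=
        h3.plane_unique (hpl hq ha hb hab) (hpl hq ha hb' hab') hq.1 ha.1 hx.1 (hne hq ha)
          hxq.symm (hne hx ha).symm (left_mem_planeThrough _ _ _) (mid_mem_planeThrough _ _ _) hxf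
          (left_mem_planeThrough _ _ _) (mid_mem_planeThrough _ _ _) hxf'
      rcases h3.eq_or_eq_of_mem_inter hP (hpl hq ha hb hab) (left_mem_planeThrough _ _ _) hq.2
        ha hb hb' hab (mid_mem_planeThrough _ _ _) (right_mem_planeThrough _ _ _)
        (hpp ▸ right_mem_planeThrough _ _ _) with e | e
      · exact absurd e.symm hab'
      · rw [e]

theorem stmt13 (S : Set Pt3) (hS : S.Finite) (h3 : NoThreeCollinear S)
    (P : Set Pt3) (hP : IsPlane P) (r s : ℕ)
    (hr : (S ∩ P).ncard = r) (hs : (S \ P).ncard = s) :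
    (planeCount S 3 : ℝ) ≥
      (s : ℝ) * (r.choose 2 : ℝ) - (1 / 2) * r * s * ((s : ℝ) - 1) := by
  have hfA : (S ∩ P).Finite := hS.subset Set.inter_subset_left
  have hfQ : (S \ P).Finite := hS.subset Set.sdiff_subset
  have h := h3.card_triples_le hS hP hfA.coe_toFinset hfQ.coe_toFinset
  rw [Finset.card_product, Finset.card_product, Finset.offDiag_card, Finset.offDiag_card,
    ← Set.ncard_eq_toFinset_card _ hfA, ← Set.ncard_eq_toFinset_card _ hfQ, hr, hs] at h
  have h' : ((s * (r * r - r) : ℕ) : ℝ) ≤ ((2 * planeCount S 3 + (s * s - s) * r : ℕ) : ℝ) :=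
    Nat.cast_le.2 h
  push_cast [Nat.cast_sub (Nat.le_mul_self r), Nat.cast_sub (Nat.le_mul_self s)] at h'
  rw [Nat.cast_choose_two]
  linarith
end
end
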